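/- Coercivity and lower bound of I in the case k₁₂ < 0: assume q > p > 0 (so k₁₂ < 0), α > 0 and 0 < β < (α k₁₂²)/|K|. Then there exist constants δ₁ > 0, δ₂ > 0 and C ∈ ℝ such that for every (ξ,ζ) ∈ 𝒜, writing ξ = ξ̄ + ξ′ and ζ = ζ̄ + ζ′ with ξ̄, ζ̄ ∈ ℝ and ξ′, ζ′ ∈ 𝓗̃, one has I(ξ,ζ) ≥ δ₁ ‖∇ξ′‖²_{L²(dx)} + δ₂ ‖∇ζ′‖²_{L²(dx)} + C. In particular I is bounded below on 𝒜 and I(ξ,ζ) → ∞ as ‖∇ξ′‖_{L²(dx)} + ‖∇ζ′‖_{L²(dx)} → ∞ within 𝒜. -/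

import Mathlib

noncomputable section

open MeasureTheory Real Filter Topology
open scoped ENNReal

abbrev Plane : Type := EuclideanSpace ℝ (Fin 2)

/-- The weighted measure dμ = h₀ dx on the plane. -/
def wMeasure (h₀ : Plane → ℝ) : Measure Plane :=
  volume.withDensity fun x => ENNReal.ofReal (h₀ x)

/-- Membership in the weighted Sobolev space 𝓗 : the (distributional) gradient is
square integrable with respect to Lebesgue measure and the function itself is square
integrable with respect to the weighted measure dμ. -/
def MemH (h₀ : Plane → ℝ) (u : Plane → ℝ) : Prop :=
  Differentiable ℝ u ∧
    Integrable (fun x => ‖gradient u x‖ ^ 2) volume ∧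
    Integrable (fun x => u x ^ 2) (wMeasure h₀)

/-- Membership in 𝓗̃, the subspace of 𝓗 of functions with zero dμ-mean. -/
def MemHt (h₀ : Plane → ℝ) (u : Plane → ℝ) : Prop :=
  MemH h₀ u ∧ ∫ x, u x ∂(wMeasure h₀) = 0

/-- The squared 𝓗-norm: ‖u‖²_𝓗 = ‖∇u‖²_{L²(dx)} + ‖u‖²_{L²(dμ)}. -/
def HnormSq (h₀ : Plane → ℝ) (u : Plane → ℝ) : ℝ :=
  (∫ x, ‖gradient u x‖ ^ 2) + ∫ x, u x ^ 2 ∂(wMeasure h₀)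

/-- The 𝓗-norm. -/
def Hnorm (h₀ : Plane → ℝ) (u : Plane → ℝ) : ℝ :=
  Real.sqrt (HnormSq h₀ u)

/-- The entry k₁₁ = (p+q)/p of the coupling matrix. -/
def k11 (p q : ℝ) : ℝ := (p + q) / p

/-- The entry k₁₂ = (p−q)/p of the coupling matrix. -/
def k12 (p q : ℝ) : ℝ := (p - q) / p

/-- The determinant |K| = 4q/p of the coupling matrix. -/
def Kdet (p q : ℝ) : ℝ := 4 * q / p

/-- The action functional I(ξ,ζ) (with σ = |K|/k₁₂²). -/
def Ifun (p q : ℝ) (f h : Plane → ℝ) (ξ ζ : Plane → ℝ) : ℝ :=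
  ∫ x, ((1 : ℝ) / 2 * ‖gradient ξ x‖ ^ 2
      + Kdet p q / (2 * k12 p q ^ 2) * ‖gradient ζ x‖ ^ 2
      + f x * ξ x + Kdet p q / k12 p q ^ 2 * h x * ζ x)

/-- The admissible set 𝒜 : pairs in 𝓗 × 𝓗 satisfying the two natural constraints. -/
def Admissible (h₀ : Plane → ℝ) (p q α β : ℝ) (U V : Plane → ℝ)
    (ξ ζ : Plane → ℝ) : Prop :=
  MemH h₀ ξ ∧ MemH h₀ ζ ∧
  Integrable (fun x => V x * Real.exp ((ξ x - ζ x) / 2)) volume ∧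
  Integrable (fun x => U x * Real.exp (-(k11 p q / (2 * k12 p q)) * ζ x)) volume ∧
  2 * Kdet p q / k11 p q * (∫ x, V x * Real.exp ((ξ x - ζ x) / 2)) = 2 * π * α ∧
  2 * k12 p q * (∫ x, U x * Real.exp (-(k11 p q / (2 * k12 p q)) * ζ x))
    + 2 * k12 p q ^ 2 / k11 p q * (∫ x, V x * Real.exp ((ξ x - ζ x) / 2)) = 2 * π * β

/-- The fundamental theorem of calculus along a segment, combined with Young's inequality. -/
lemma enorm_sub_le_lintegral_gradient {u : Plane → ℝ} (hu : Differentiable ℝ u) (x v : Plane)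
    {ε : ℝ} (hε : 0 < ε) :
    ‖u (x + v) - u x‖ₑ ≤ ENNReal.ofReal (‖v‖ ^ 2 / (4 * ε)) +
      ENNReal.ofReal ε * ∫⁻ t in Set.Ioc (0 : ℝ) 1,
        ENNReal.ofReal (‖gradient u (x + t • v)‖ ^ 2) := by
  set L := ∫⁻ t in Set.Ioc (0 : ℝ) 1, ENNReal.ofReal (‖gradient u (x + t • v)‖ ^ 2) with hL
  by_cases htop : L = ⊤
  · rw [htop, ENNReal.mul_top (by simpa using hε)]
    simp
  have hder (t : ℝ) : HasDerivAt (fun s : ℝ => u (x + s • v)) (fderiv ℝ u (x + t • v) v) t := by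
    have h₁ : HasDerivAt (fun s : ℝ => x + s • v) v t := by
      simpa using ((hasDerivAt_id t).smul_const v).const_add x
    exact (hu (x + t • v)).hasFDerivAt.comp_hasDerivAt t h₁
  have hmeas : Measurable fun t : ℝ => fderiv ℝ u (x + t • v) v :=
    (measurable_fderiv_apply_const ℝ u v).comp (by fun_prop)
  have hbound (t : ℝ) : ‖fderiv ℝ u (x + t • v) v‖ₑ ≤ ENNReal.ofReal (‖v‖ ^ 2 / (4 * ε)) +
      ENNReal.ofReal ε * ENNReal.ofReal (‖gradient u (x + t • v)‖ ^ 2) := by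
    rw [← ENNReal.ofReal_mul hε.le, ← ENNReal.ofReal_add (by positivity) (by positivity),
      ← ofReal_norm]
    refine ENNReal.ofReal_le_ofReal ?_
    have h₁ : ‖fderiv ℝ u (x + t • v) v‖ ≤ ‖gradient u (x + t • v)‖ * ‖v‖ := by
      simpa [gradient] using (fderiv ℝ u (x + t • v)).le_opNorm v
    refine h₁.trans ?_
    set a := ‖gradient u (x + t • v)‖
    have h₂ : ‖v‖ ^ 2 / (4 * ε) + ε * a ^ 2 - a * ‖v‖ = (‖v‖ - 2 * ε * a) ^ 2 / (4 * ε) := by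
      field_simp
      ring
    have h₃ : 0 ≤ (‖v‖ - 2 * ε * a) ^ 2 / (4 * ε) := by positivity
    linarith
  have hlint : ∫⁻ t in Set.Ioc (0 : ℝ) 1, ‖fderiv ℝ u (x + t • v) v‖ₑ ≤
      ENNReal.ofReal (‖v‖ ^ 2 / (4 * ε)) + ENNReal.ofReal ε * L := by
    refine (lintegral_mono hbound).trans ?_
    rw [lintegral_add_left measurable_const, lintegral_const_mul' _ _ ENNReal.ofReal_ne_top]
    simp [hL]
  have hint : IntervalIntegrable (fun t : ℝ => fderiv ℝ u (x + t • v) v) volume 0 1 := by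
    rw [intervalIntegrable_iff_integrableOn_Ioc_of_le zero_le_one]
    refine ⟨hmeas.aestronglyMeasurable, hlint.trans_lt ?_⟩
    exact ENNReal.add_lt_top.2
      ⟨ENNReal.ofReal_lt_top, ENNReal.mul_lt_top ENNReal.ofReal_lt_top (lt_top_iff_ne_top.2 htop)⟩
  have hftc := intervalIntegral.integral_eq_sub_of_hasDerivAt (fun t _ => hder t) hint
  simp only [one_smul, zero_smul, add_zero] at hftc
  rw [← hftc, intervalIntegral.integral_of_le zero_le_one]
  exact (enorm_integral_le_lintegral_enorm _).trans hlint

lemma lintegral_comp_smul_add_const_le (G : Plane → ℝ≥0∞) (hG : Measurable G) {r : ℝ}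
    (hr : 1 / 2 ≤ r) (z : Plane) : ∫⁻ x, G (r • x + z) ≤ 4 * ∫⁻ x, G x := by
  have hr0 : r ≠ 0 := by linarith
  have h₁ : ∫⁻ x, G (r • x + z) = ∫⁻ y, G (y + z) ∂(Measure.map (r • ·) volume) :=
    (lintegral_map (hG.comp (measurable_id.add_const z)) (measurable_const_smul r)).symm
  rw [h₁, Measure.map_addHaar_smul _ hr0, lintegral_smul_measure, lintegral_add_right_eq_self,
    smul_eq_mul]
  gcongr
  rw [show (4 : ℝ≥0∞) = ENNReal.ofReal 4 by norm_num]
  refine ENNReal.ofReal_le_ofReal ?_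
  simp only [finrank_euclideanSpace, Fintype.card_fin]
  rw [abs_of_nonneg (by positivity)]
  refine inv_le_of_inv_le₀ (by positivity) ?_
  nlinarith

/-- A Poincaré-type bound for the double integral of differences. -/
lemma lintegral_lintegral_enorm_sub_le (μ : Measure Plane) [IsFiniteMeasure μ] {K : ℝ≥0∞}
    (hK : μ ≤ K • volume) {u : Plane → ℝ} (hu : Differentiable ℝ u) {ε : ℝ} (hε : 0 < ε) :
    ∫⁻ x, ∫⁻ y, ‖u x - u y‖ₑ ∂μ ∂μ ≤
      4 * μ Set.univ * ENNReal.ofReal (1 / ε) * ∫⁻ x, ENNReal.ofReal (‖x‖ ^ 2) ∂μ +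
      8 * μ Set.univ * K * ENNReal.ofReal ε * ∫⁻ x, ENNReal.ofReal (‖gradient u x‖ ^ 2) := by
  have huc := hu.continuous
  have hgm : Measurable fun x => ENNReal.ofReal (‖gradient u x‖ ^ 2) := by
    have h₁ : Measurable (gradient u) :=
      (InnerProductSpace.toDual ℝ Plane).symm.continuous.measurable.comp (measurable_fderiv ℝ u)
    fun_prop
  set G : Plane → ℝ≥0∞ := fun x => ENNReal.ofReal (‖gradient u x‖ ^ 2) with hG
  set A := ∫⁻ x, ENNReal.ofReal (‖x‖ ^ 2) ∂μ with hA
  set m := μ Set.univ with hm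
  let P : Plane → Plane → ℝ≥0∞ := fun x y => ‖u (x + (1 / 2 : ℝ) • (y - x)) - u x‖ₑ
  have hPm : Measurable (Function.uncurry P) := by
    apply Continuous.measurable
    simp only [P, Function.uncurry_def]
    fun_prop
  have hswap : ∫⁻ x, ∫⁻ y, P y x ∂μ ∂μ = ∫⁻ x, ∫⁻ y, P x y ∂μ ∂μ :=
    (lintegral_lintegral_swap hPm.aemeasurable).symm
  have htri (x y : Plane) : ‖u x - u y‖ₑ ≤ P x y + P y x := by
    have hmid : y + (1 / 2 : ℝ) • (x - y) = x + (1 / 2 : ℝ) • (y - x) := by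
      module
    simp only [P, hmid]
    set z := u (x + (1 / 2 : ℝ) • (y - x))
    calc ‖u x - u y‖ₑ = ‖(z - u y) - (z - u x)‖ₑ := by congr 1; ring
      _ ≤ ‖z - u y‖ₑ + ‖z - u x‖ₑ := enorm_sub_le
      _ = _ := add_comm _ _
  have hsum : ∫⁻ x, ∫⁻ y, ‖u x - u y‖ₑ ∂μ ∂μ ≤ 2 * ∫⁻ x, ∫⁻ y, P x y ∂μ ∂μ := by
    calc _ ≤ ∫⁻ x, ∫⁻ y, (P x y + P y x) ∂μ ∂μ :=
          lintegral_mono fun x => lintegral_mono fun y => htri x y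
      _ = ∫⁻ x, (∫⁻ y, P x y ∂μ + ∫⁻ y, P y x ∂μ) ∂μ := by
          refine lintegral_congr fun x => lintegral_add_left ?_ _
          exact hPm.comp measurable_prodMk_left
      _ = ∫⁻ x, ∫⁻ y, P x y ∂μ ∂μ + ∫⁻ x, ∫⁻ y, P y x ∂μ ∂μ :=
          lintegral_add_left hPm.lintegral_prod_right _
      _ = _ := by rw [hswap, two_mul]
  have hPle (x y : Plane) : P x y ≤
      ENNReal.ofReal (1 / ε) * (ENNReal.ofReal (‖x‖ ^ 2) + ENNReal.ofReal (‖y‖ ^ 2)) +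
      ENNReal.ofReal ε * ∫⁻ t in Set.Ioc (0 : ℝ) 1, G ((1 - t / 2) • x + (t / 2) • y) := by
    refine (enorm_sub_le_lintegral_gradient hu x _ hε).trans (add_le_add ?_ (le_of_eq ?_))
    · rw [← ENNReal.ofReal_add (by positivity) (by positivity),
        ← ENNReal.ofReal_mul (by positivity)]
      refine ENNReal.ofReal_le_ofReal ?_
      rw [norm_smul, div_mul_eq_mul_div, one_mul, div_le_div_iff₀ (by positivity) hε]
      have h₁ : ‖y - x‖ ≤ ‖y‖ + ‖x‖ := norm_sub_le _ _
      have h₂ : ‖y - x‖ ^ 2 ≤ 2 * (‖x‖ ^ 2 + ‖y‖ ^ 2) := by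
        nlinarith [norm_nonneg (y - x), sq_nonneg (‖y‖ - ‖x‖)]
      rw [Real.norm_of_nonneg (by norm_num : (0 : ℝ) ≤ 1 / 2)]
      nlinarith [norm_nonneg (y - x), sq_nonneg ‖x‖, sq_nonneg ‖y‖]
    · congr 1
      refine lintegral_congr fun t => ?_
      rw [show x + t • (1 / 2 : ℝ) • (y - x) = (1 - t / 2) • x + (t / 2) • y by module]
  have hQ (y : Plane) :
      ∫⁻ x, (∫⁻ t in Set.Ioc (0 : ℝ) 1, G ((1 - t / 2) • x + (t / 2) • y)) ∂μ ≤
        4 * K * ∫⁻ x, G x := by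
    rw [lintegral_lintegral_swap (by
      apply Measurable.aemeasurable
      apply hgm.comp
      fun_prop)]
    calc _ ≤ ∫⁻ t in Set.Ioc (0 : ℝ) 1, 4 * K * ∫⁻ x, G x := by
          refine setLIntegral_mono' measurableSet_Ioc fun t ht => ?_
          calc _ ≤ ∫⁻ x, G ((1 - t / 2) • x + (t / 2) • y) ∂(K • volume) := lintegral_mono' hK le_rfl
            _ ≤ _ := by
              rw [lintegral_smul_measure, smul_eq_mul, mul_comm 4 K, mul_assoc]
              gcongr
              exact lintegral_comp_smul_add_const_le G hgm (by linarith [ht.2]) _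
      _ = _ := by simp
  have hnm : Measurable fun x : Plane => ENNReal.ofReal (‖x‖ ^ 2) := by fun_prop
  have hmain : ∫⁻ x, ∫⁻ y, P x y ∂μ ∂μ ≤
      2 * m * ENNReal.ofReal (1 / ε) * A + 4 * m * K * ENNReal.ofReal ε * ∫⁻ x, G x := by
    rw [← hswap]
    calc _ ≤ ∫⁻ y, (ENNReal.ofReal (1 / ε) * (A + m * ENNReal.ofReal (‖y‖ ^ 2)) +
            ENNReal.ofReal ε * (4 * K * ∫⁻ x, G x)) ∂μ := by
          refine lintegral_mono fun y => (lintegral_mono fun x => hPle x y).trans ?_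
          rw [lintegral_add_left (by fun_prop), lintegral_const_mul' _ _ ENNReal.ofReal_ne_top,
            lintegral_const_mul' _ _ ENNReal.ofReal_ne_top, lintegral_add_left hnm,
            lintegral_const, mul_comm (ENNReal.ofReal (‖y‖ ^ 2))]
          gcongr
          exact hQ y
      _ = _ := by
          rw [lintegral_add_right _ measurable_const, lintegral_const_mul' _ _ ENNReal.ofReal_ne_top,
            lintegral_add_left measurable_const, lintegral_const_mul _ hnm, lintegral_const,
            lintegral_const]
          ring
  calc _ ≤ _ := hsum
    _ ≤ 2 * (2 * m * ENNReal.ofReal (1 / ε) * A +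
        4 * m * K * ENNReal.ofReal ε * ∫⁻ x, G x) := by gcongr
    _ = _ := by ring

lemma weight_le_one_add_norm_rpow {κ : ℝ} (hκ : 0 < κ) {h₀ : Plane → ℝ} (hc : Continuous h₀)
    (h₀eq : ∀ x : Plane, 1 ≤ ‖x‖ → h₀ x = ‖x‖ ^ (-κ)) :
    ∃ C : ℝ, 0 < C ∧ ∀ x, h₀ x ≤ C * (1 + ‖x‖) ^ (-κ) := by
  obtain ⟨B, hB⟩ := (isCompact_closedBall (0 : Plane) 1).exists_bound_of_continuousOn hc.continuousOn
  refine ⟨(max B 1) * 2 ^ κ, by positivity, fun x => ?_⟩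
  have hsplit : (2 : ℝ) ^ κ * (1 + ‖x‖) ^ (-κ) = ((1 + ‖x‖) / 2) ^ (-κ) := by
    rw [Real.div_rpow (by positivity) (by norm_num), Real.rpow_neg (by norm_num : (0 : ℝ) ≤ 2)]
    field_simp
  rw [mul_assoc, hsplit]
  have hpos : 0 < ((1 + ‖x‖) / 2) ^ (-κ) := by positivity
  rcases le_total 1 ‖x‖ with hx | hx
  · rw [h₀eq x hx]
    calc ‖x‖ ^ (-κ) ≤ ((1 + ‖x‖) / 2) ^ (-κ) :=
          Real.rpow_le_rpow_of_nonpos (by positivity) (by linarith) (by linarith)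
      _ ≤ _ := le_mul_of_one_le_left hpos.le (le_max_right _ _)
  · have h₁ : h₀ x ≤ B := (le_abs_self _).trans (hB x (by simpa using hx))
    have h₂ : 1 ≤ ((1 + ‖x‖) / 2) ^ (-κ) :=
      Real.one_le_rpow_of_pos_of_le_one_of_nonpos (by positivity) (by linarith) (by linarith)
    calc h₀ x ≤ max B 1 := h₁.trans (le_max_left _ _)
      _ ≤ _ := le_mul_of_one_le_right (by positivity) h₂

lemma lintegral_wMeasure {h₀ : Plane → ℝ} (hc : Continuous h₀) {φ : Plane → ℝ≥0∞}
    (hφ : Measurable φ) :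
    ∫⁻ x, φ x ∂(wMeasure h₀) = ∫⁻ x, ENNReal.ofReal (h₀ x) * φ x :=
  lintegral_withDensity_eq_lintegral_mul _ (by fun_prop) hφ

lemma isFiniteMeasure_wMeasure {κ : ℝ} (hκ : 2 < κ) {h₀ : Plane → ℝ} (hc : Continuous h₀)
    (h₀eq : ∀ x : Plane, 1 ≤ ‖x‖ → h₀ x = ‖x‖ ^ (-κ)) : IsFiniteMeasure (wMeasure h₀) := by
  obtain ⟨C, hC, hle⟩ := weight_le_one_add_norm_rpow (by linarith) hc h₀eq
  have hint : Integrable fun x : Plane => C * (1 + ‖x‖) ^ (-κ) :=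
    (integrable_one_add_norm (by simpa using hκ)).const_mul C
  refine isFiniteMeasure_withDensity (ne_top_of_le_ne_top hint.lintegral_lt_top.ne ?_)
  exact lintegral_mono fun x => ENNReal.ofReal_le_ofReal (hle x)

lemma lintegral_norm_sq_wMeasure_ne_top {κ : ℝ} (hκ : 4 < κ) {h₀ : Plane → ℝ}
    (hc : Continuous h₀) (h₀eq : ∀ x : Plane, 1 ≤ ‖x‖ → h₀ x = ‖x‖ ^ (-κ)) :
    ∫⁻ x, ENNReal.ofReal (‖x‖ ^ 2) ∂(wMeasure h₀) ≠ ⊤ := by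
  obtain ⟨C, hC, hle⟩ := weight_le_one_add_norm_rpow (by linarith) hc h₀eq
  have hint : Integrable fun x : Plane => C * (1 + ‖x‖) ^ (-(κ - 2)) :=
    (integrable_one_add_norm (by
      simp only [finrank_euclideanSpace, Fintype.card_fin, Nat.cast_ofNat]
      linarith)).const_mul C
  rw [lintegral_wMeasure hc (by fun_prop)]
  refine ne_top_of_le_ne_top hint.lintegral_lt_top.ne (lintegral_mono fun x => ?_)
  rw [mul_comm, ← ENNReal.ofReal_mul (by positivity)]
  refine ENNReal.ofReal_le_ofReal ?_
  have h₁ : (1 + ‖x‖) ^ (-(κ - 2)) = (1 + ‖x‖) ^ 2 * (1 + ‖x‖) ^ (-κ) := by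
    rw [← Real.rpow_natCast, ← Real.rpow_add (by positivity)]
    congr 1
    push_cast
    ring
  have h₂ : ‖x‖ ^ 2 ≤ (1 + ‖x‖) ^ 2 := by
    gcongr
    linarith
  calc ‖x‖ ^ 2 * h₀ x ≤ ‖x‖ ^ 2 * (C * (1 + ‖x‖) ^ (-κ)) := by gcongr; exact hle x
    _ ≤ (1 + ‖x‖) ^ 2 * (C * (1 + ‖x‖) ^ (-κ)) := by gcongr
    _ = _ := by rw [h₁]; ring

lemma wMeasure_le_smul_volume {κ : ℝ} (hκ : 0 < κ) {h₀ : Plane → ℝ}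
    (hc : Continuous h₀) (h₀eq : ∀ x : Plane, 1 ≤ ‖x‖ → h₀ x = ‖x‖ ^ (-κ)) :
    ∃ K : ℝ, 0 < K ∧ wMeasure h₀ ≤ ENNReal.ofReal K • volume := by
  obtain ⟨C, hC, hle⟩ := weight_le_one_add_norm_rpow hκ hc h₀eq
  refine ⟨C, hC, ?_⟩
  rw [← withDensity_const]
  refine withDensity_mono (ae_of_all _ fun x => ENNReal.ofReal_le_ofReal ((hle x).trans ?_))
  exact mul_le_of_le_one_right hC.le (Real.rpow_le_one_of_one_le_of_nonpos
    (by linarith [norm_nonneg x]) (by linarith))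

lemma wMeasure_univ_ne_zero {h₀ : Plane → ℝ} (hc : Continuous h₀) (hpos : ∀ x, 0 < h₀ x) :
    wMeasure h₀ Set.univ ≠ 0 := by
  rw [Ne, Measure.measure_univ_eq_zero, wMeasure,
    withDensity_eq_zero_iff (by fun_prop : AEMeasurable (fun x => ENNReal.ofReal (h₀ x)) volume)]
  intro h
  have h₁ : (fun _ : Plane => False) =ᵐ[volume] fun _ => True := by
    filter_upwards [h] with x hx
    simp [(hpos x).not_ge] at hx
  have h₂ : (volume : Measure Plane) = 0 := by
    rw [← ae_eq_bot]
    by_contra hne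
    have : (ae (volume : Measure Plane)).NeBot := ⟨hne⟩
    obtain ⟨x, hx⟩ := h₁.exists
    simp at hx
  exact NeZero.ne (volume : Measure Plane) h₂

lemma MemHt.integrable {h₀ : Plane → ℝ} [IsFiniteMeasure (wMeasure h₀)] {u : Plane → ℝ}
    (hu : MemHt h₀ u) : Integrable u (wMeasure h₀) := by
  have h₁ : MemLp u 2 (wMeasure h₀) :=
    (memLp_two_iff_integrable_sq hu.1.1.continuous.aestronglyMeasurable).2 hu.1.2.2
  exact h₁.integrable (by norm_num)

/-- On mean-zero functions, pairing with a compactly supported continuous function is controlled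
by an arbitrarily small multiple of the Dirichlet energy, up to a constant. -/
lemma exists_abs_integral_mul_le {κ : ℝ} (hκ : 4 < κ) {h₀ : Plane → ℝ}
    (hc : Continuous h₀) (hpos : ∀ x, 0 < h₀ x)
    (h₀eq : ∀ x : Plane, 1 ≤ ‖x‖ → h₀ x = ‖x‖ ^ (-κ))
    {f : Plane → ℝ} (hf : Continuous f) (hfs : HasCompactSupport f) {η : ℝ} (hη : 0 < η) :
    ∃ C : ℝ, ∀ u : Plane → ℝ, MemHt h₀ u →
      |∫ x, f x * u x| ≤ η * (∫ x, ‖gradient u x‖ ^ 2) + C := by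
  have := isFiniteMeasure_wMeasure (by linarith) hc h₀eq
  obtain ⟨K, hK, hμK⟩ := wMeasure_le_smul_volume (by linarith) hc h₀eq
  set μ := wMeasure h₀ with hμ
  obtain ⟨L, hL⟩ : ∃ L : ℝ, ∀ x, ‖f x / h₀ x‖ ≤ L := by
    have hs : HasCompactSupport fun x => f x / h₀ x := by
      simp only [div_eq_mul_inv]
      exact hfs.mul_right
    exact (hf.div hc fun x => (hpos x).ne').bounded_above_of_compact_support hs
  have hL0 : 0 ≤ L := (norm_nonneg _).trans (hL 0)
  have hfL (x : Plane) : |f x| ≤ L * h₀ x := by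
    have := hL x
    rwa [norm_div, Real.norm_eq_abs, Real.norm_eq_abs, abs_of_pos (hpos x),
      div_le_iff₀ (hpos x)] at this
  set m := μ.real Set.univ with hm
  have hm0 : 0 < m := ENNReal.toReal_pos (wMeasure_univ_ne_zero hc hpos) (measure_ne_top _ _)
  have hmE : μ Set.univ = ENNReal.ofReal m := (ENNReal.ofReal_toReal (measure_ne_top _ _)).symm
  set A := (∫⁻ x, ENNReal.ofReal (‖x‖ ^ 2) ∂μ).toReal with hA
  have hA0 : 0 ≤ A := ENNReal.toReal_nonneg
  have hAE : ∫⁻ x, ENNReal.ofReal (‖x‖ ^ 2) ∂μ = ENNReal.ofReal A :=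
    (ENNReal.ofReal_toReal (lintegral_norm_sq_wMeasure_ne_top hκ hc h₀eq)).symm
  set ε := η / (8 * K * L + 1) with hε
  have hε0 : 0 < ε := by positivity
  refine ⟨L * (4 * (1 / ε) * A), fun u hu => ?_⟩
  have huc := hu.1.1.continuous
  set D := ∫ x, ‖gradient u x‖ ^ 2 with hD
  have hD0 : 0 ≤ D := integral_nonneg fun x => by positivity
  have hDE : ∫⁻ x, ENNReal.ofReal (‖gradient u x‖ ^ 2) = ENNReal.ofReal D :=
    (ofReal_integral_eq_lintegral_ofReal hu.1.2.1 (ae_of_all _ fun x => by positivity)).symm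
  have hosc := lintegral_lintegral_enorm_sub_le μ hμK hu.1.1 hε0
  rw [hmE, hAE, hDE] at hosc
  have hmean (x : Plane) : ENNReal.ofReal m * ‖u x‖ₑ ≤ ∫⁻ y, ‖u x - u y‖ₑ ∂μ := by
    have h₁ : ∫ y, (u x - u y) ∂μ = m * u x := by
      rw [integral_sub (integrable_const _) hu.integrable, hu.2, integral_const, sub_zero,
        smul_eq_mul]
    calc ENNReal.ofReal m * ‖u x‖ₑ = ‖∫ y, (u x - u y) ∂μ‖ₑ := by
          rw [h₁, enorm_mul, Real.enorm_of_nonneg hm0.le]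
      _ ≤ _ := enorm_integral_le_lintegral_enorm _
  have hφm : Measurable fun x => ∫⁻ y, ‖u x - u y‖ₑ ∂μ := by
    refine Measurable.lintegral_prod_right ?_
    apply Continuous.measurable
    simp only [Function.uncurry_def]
    fun_prop
  have hkey : ENNReal.ofReal (m * |∫ x, f x * u x|) ≤
      ENNReal.ofReal (L * (4 * m * (1 / ε) * A + 8 * m * K * ε * D)) := by
    calc ENNReal.ofReal (m * |∫ x, f x * u x|)
        = ENNReal.ofReal m * ‖∫ x, f x * u x‖ₑ := by
          rw [ENNReal.ofReal_mul hm0.le, ← ofReal_norm, Real.norm_eq_abs]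
      _ ≤ ENNReal.ofReal m * ∫⁻ x, ‖f x * u x‖ₑ := by
          gcongr
          exact enorm_integral_le_lintegral_enorm _
      _ = ∫⁻ x, ENNReal.ofReal m * ‖f x * u x‖ₑ :=
          (lintegral_const_mul' _ _ ENNReal.ofReal_ne_top).symm
      _ ≤ ∫⁻ x, ENNReal.ofReal L * (ENNReal.ofReal (h₀ x) * ∫⁻ y, ‖u x - u y‖ₑ ∂μ) := by
          refine lintegral_mono fun x => ?_
          calc ENNReal.ofReal m * ‖f x * u x‖ₑ = ‖f x‖ₑ * (ENNReal.ofReal m * ‖u x‖ₑ) := by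
                rw [enorm_mul]; ring
            _ ≤ ENNReal.ofReal (L * h₀ x) * ∫⁻ y, ‖u x - u y‖ₑ ∂μ := by
                gcongr
                · rw [← ofReal_norm]
                  exact ENNReal.ofReal_le_ofReal (hfL x)
                · exact hmean x
            _ = _ := by rw [ENNReal.ofReal_mul hL0, mul_assoc]
      _ = ENNReal.ofReal L * ∫⁻ x, ∫⁻ y, ‖u x - u y‖ₑ ∂μ ∂μ := by
          rw [lintegral_const_mul' _ _ ENNReal.ofReal_ne_top, hμ, lintegral_wMeasure hc hφm]
      _ ≤ ENNReal.ofReal L *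
          (4 * ENNReal.ofReal m * ENNReal.ofReal (1 / ε) * ENNReal.ofReal A +
            8 * ENNReal.ofReal m * ENNReal.ofReal K * ENNReal.ofReal ε * ENNReal.ofReal D) := by
          gcongr
      _ = _ := by
          rw [ENNReal.ofReal_mul hL0, ENNReal.ofReal_add (by positivity) (by positivity),
            ENNReal.ofReal_mul (by positivity), ENNReal.ofReal_mul (by positivity),
            ENNReal.ofReal_mul (by positivity), ENNReal.ofReal_mul (by positivity),
            ENNReal.ofReal_mul (by positivity), ENNReal.ofReal_mul (by positivity),
            ENNReal.ofReal_mul (by positivity)]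
          norm_num
  have hreal := (ENNReal.ofReal_le_ofReal_iff (by positivity)).1 hkey
  have h₁ : |∫ x, f x * u x| ≤ L * (4 * (1 / ε) * A) + 8 * K * L * ε * D := by
    refine le_of_mul_le_mul_left (hreal.trans (le_of_eq ?_)) hm0
    ring
  have h₂ : 8 * K * L * ε ≤ η := by
    rw [hε, mul_div_assoc', div_le_iff₀ (by positivity)]
    nlinarith
  nlinarith [mul_le_mul_of_nonneg_right h₂ hD0]

/-- Jensen's inequality bounds the mean of a function whose exponential integral against a
log-integrable weight is prescribed. -/
lemma exists_forall_mean_le {κ : ℝ} (hκ : 4 < κ) {h₀ : Plane → ℝ}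
    (hc : Continuous h₀) (hpos : ∀ x, 0 < h₀ x)
    (h₀eq : ∀ x : Plane, 1 ≤ ‖x‖ → h₀ x = ‖x‖ ^ (-κ))
    {V : Plane → ℝ} (hVnn : ∀ x, 0 ≤ V x) {S : Set Plane} (hS : S.Finite)
    (hVpos : ∀ x ∉ S, 0 < V x)
    (hlog : Integrable (fun x => Real.log (V x)) (wMeasure h₀)) (A : ℝ) :
    ∃ B : ℝ, ∀ (w : Plane → ℝ) (b : ℝ), Integrable w (wMeasure h₀) →
      ∫ x, w x ∂(wMeasure h₀) = 0 →
      Integrable (fun x => V x * Real.exp (b + w x)) volume →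
      ∫ x, V x * Real.exp (b + w x) = A → b ≤ B := by
  have := isFiniteMeasure_wMeasure (by linarith) hc h₀eq
  obtain ⟨K, hK, hμK⟩ := wMeasure_le_smul_volume (by linarith) hc h₀eq
  set μ := wMeasure h₀ with hμ
  have hμ0 : μ Set.univ ≠ 0 := wMeasure_univ_ne_zero hc hpos
  have : NeZero μ := ⟨fun h => hμ0 (by simp [h])⟩
  set m := μ.real Set.univ with hm
  have hm0 : 0 < m := ENNReal.toReal_pos hμ0 (measure_ne_top _ _)
  have hae : ∀ᵐ x ∂μ, 0 < V x := by
    have h₁ : ∀ᵐ x ∂(volume : Measure Plane), x ∉ S :=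
      hS.countable.ae_notMem volume
    have h₂ : ∀ᵐ x ∂μ, x ∉ S := (withDensity_absolutelyContinuous _ _).ae_le h₁
    exact h₂.mono fun x hx => hVpos x hx
  refine ⟨Real.log (m⁻¹ * (K * A)) - m⁻¹ * ∫ x, Real.log (V x) ∂μ, fun w b hw hw0 hint hA => ?_⟩
  have hintK : Integrable (fun x => V x * Real.exp (b + w x)) (ENNReal.ofReal K • volume) :=
    hint.smul_measure ENNReal.ofReal_ne_top
  have hae' : (fun x => V x * Real.exp (b + w x)) =ᵐ[μ]
      Real.exp ∘ fun x => Real.log (V x) + (b + w x) := by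
    filter_upwards [hae] with x hx
    simp [Real.exp_add, Real.exp_log hx]
  have hsum : Integrable (fun x => Real.log (V x) + (b + w x)) μ :=
    hlog.add ((integrable_const b).add hw)
  have hjensen := convexOn_exp.map_average_le Real.continuous_exp.continuousOn isClosed_univ
    (ae_of_all μ fun x => Set.mem_univ (Real.log (V x) + (b + w x))) hsum
    ((hintK.mono_measure hμK).congr hae')
  have hle : ∫ x, Real.exp (Real.log (V x) + (b + w x)) ∂μ ≤ K * A := by
    calc _ = ∫ x, V x * Real.exp (b + w x) ∂μ := (integral_congr_ae hae').symm
      _ ≤ ∫ x, V x * Real.exp (b + w x) ∂(ENNReal.ofReal K • volume) :=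
          integral_mono_measure hμK (ae_of_all _ fun x => mul_nonneg (hVnn x) (Real.exp_pos _).le)
            hintK
      _ = _ := by rw [integral_smul_measure, ENNReal.toReal_ofReal hK.le, hA, smul_eq_mul]
  have havg : ⨍ x, (Real.log (V x) + (b + w x)) ∂μ = m⁻¹ * (∫ x, Real.log (V x) ∂μ) + b := by
    have h₁ : ∫ x, (b + w x) ∂μ = m * b := by
      rw [integral_add (integrable_const b) hw, hw0, integral_const, smul_eq_mul, add_zero]
    rw [average_eq, integral_add hlog (g := fun x => b + w x) ((integrable_const b).add hw), h₁,
      smul_eq_mul, ← hm]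
    field_simp
  rw [havg, average_eq, smul_eq_mul] at hjensen
  have hfin : Real.exp (m⁻¹ * (∫ x, Real.log (V x) ∂μ) + b) ≤ m⁻¹ * (K * A) :=
    hjensen.trans (by gcongr)
  have := (Real.le_log_iff_exp_le ((Real.exp_pos _).trans_le hfin)).2 hfin
  linarith

lemma integrable_mul_of_hasCompactSupport {f u : Plane → ℝ} (hf : Continuous f)
    (hfs : HasCompactSupport f) (hu : Continuous u) : Integrable fun x => f x * u x :=
  (hf.mul hu).integrable_of_hasCompactSupport hfs.mul_right

lemma integral_mul_const_add {f u : Plane → ℝ} (hf : Continuous f)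
    (hfs : HasCompactSupport f) (hu : Continuous u) (b : ℝ) :
    ∫ x, f x * (b + u x) = (∫ x, f x) * b + ∫ x, f x * u x := by
  simp only [mul_add]
  rw [integral_add ((hf.integrable_of_hasCompactSupport hfs).mul_const b)
    (integrable_mul_of_hasCompactSupport hf hfs hu), integral_mul_const]

lemma gradient_const_add (b : ℝ) (u : Plane → ℝ) (x : Plane) :
    gradient (fun y => b + u y) x = gradient u x := by
  simp [gradient]

lemma Ifun_const_add {h₀ : Plane → ℝ} (p q : ℝ) {f h : Plane → ℝ}
    (hf : Continuous f) (hfs : HasCompactSupport f) (hh : Continuous h) (hhs : HasCompactSupport h)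
    {u v : Plane → ℝ} (hu : MemH h₀ u) (hv : MemH h₀ v) (a b : ℝ) :
    Ifun p q f h (fun x => a + u x) (fun x => b + v x) =
      1 / 2 * (∫ x, ‖gradient u x‖ ^ 2) +
      Kdet p q / (2 * k12 p q ^ 2) * (∫ x, ‖gradient v x‖ ^ 2) +
      ((∫ x, f x) * a + ∫ x, f x * u x) +
      Kdet p q / k12 p q ^ 2 * ((∫ x, h x) * b + ∫ x, h x * v x) := by
  have huc : Continuous fun x => a + u x := continuous_const.add hu.1.continuous
  have hvc : Continuous fun x => b + v x := continuous_const.add hv.1.continuous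
  have h₁ := hu.2.1.const_mul (1 / 2)
  have h₂ := hv.2.1.const_mul (Kdet p q / (2 * k12 p q ^ 2))
  have h₃ := integrable_mul_of_hasCompactSupport hf hfs huc
  have h₄ := (integrable_mul_of_hasCompactSupport hh hhs hvc).const_mul (Kdet p q / k12 p q ^ 2)
  simp only [Ifun, gradient_const_add, mul_assoc (Kdet p q / k12 p q ^ 2)]
  rw [integral_add (by exact (h₁.add h₂).add h₃) h₄, integral_add (by exact h₁.add h₂) h₃,
    integral_add h₁ h₂, integral_const_mul, integral_const_mul, integral_const_mul,
    integral_mul_const_add hf hfs hu.1.continuous, integral_mul_const_add hh hhs hv.1.continuous]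

/-- Coercivity and lower bound of I on 𝒜 when k₁₂ < 0 (i.e. q > p > 0). -/
theorem coercivity_k12_neg
    (κ : ℝ) (hκ : 4 < κ) (h₀ : Plane → ℝ)
    (h₀smooth : ContDiff ℝ (⊤ : ℕ∞) h₀) (h₀pos : ∀ x, 0 < h₀ x)
    (h₀eq : ∀ x : Plane, 1 ≤ ‖x‖ → h₀ x = ‖x‖ ^ (-κ))
    (p q : ℝ) (hp : 0 < p) (hq : 0 < q) (hpq : p ≠ q)
    (α β : ℝ)
    (f h : Plane → ℝ)
    (hfcont : Continuous f) (hfsupp : HasCompactSupport f)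
    (hhcont : Continuous h) (hhsupp : HasCompactSupport h)
    (hfint : ∫ x, f x = -(2 * π * α)) (hhint : ∫ x, h x = 2 * π * β)
    (U V : Plane → ℝ)
    (hUcont : Continuous U) (hVcont : Continuous V)
    (hUnn : ∀ x, 0 ≤ U x) (hVnn : ∀ x, 0 ≤ V x)
    (SU SV : Set Plane) (hSU : SU.Finite) (hSV : SV.Finite)
    (hUpos : ∀ x ∉ SU, 0 < U x) (hVpos : ∀ x ∉ SV, 0 < V x)
    (hlogU : Integrable (fun x => Real.log (U x)) (wMeasure h₀))
    (hlogV : Integrable (fun x => Real.log (V x)) (wMeasure h₀))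
    (CUV : ℝ) (hCUV : 0 < CUV)
    (hUbd : ∀ x, U x ≤ CUV * Real.exp (-‖x‖))
    (hVbd : ∀ x, V x ≤ CUV * Real.exp (-‖x‖))
    (hqp : p < q) (hα : 0 < α) (hβ0 : 0 < β)
    (hβ : β < α * k12 p q ^ 2 / Kdet p q) :
    ∃ δ₁ δ₂ C : ℝ, 0 < δ₁ ∧ 0 < δ₂ ∧
      ∀ (ξ ζ : Plane → ℝ) (ξb ζb : ℝ) (ξ' ζ' : Plane → ℝ),
        Admissible h₀ p q α β U V ξ ζ →
        MemHt h₀ ξ' → MemHt h₀ ζ' →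
        (∀ x, ξ x = ξb + ξ' x) → (∀ x, ζ x = ζb + ζ' x) →
        δ₁ * (∫ x, ‖gradient ξ' x‖ ^ 2) + δ₂ * (∫ x, ‖gradient ζ' x‖ ^ 2) + C ≤
          Ifun p q f h ξ ζ := by
  have hc := h₀smooth.continuous
  have := isFiniteMeasure_wMeasure (by linarith) hc h₀eq
  have hk₁₁ : 0 < k11 p q := by unfold k11; positivity
  have hk₁₂ : k12 p q < 0 := div_neg_of_neg_of_pos (by linarith) hp
  have hK : 0 < Kdet p q := by unfold Kdet; positivity
  set A : ℝ := k11 p q / (2 * Kdet p q) * (2 * π * α) with hA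
  set B : ℝ := (2 * π * β - 2 * k12 p q ^ 2 / k11 p q * A) / (2 * k12 p q) with hB
  set c : ℝ := -(k11 p q / (2 * k12 p q)) with hcdef
  have hcpos : 0 < c := neg_pos.2 (div_neg_of_pos_of_neg hk₁₁ (by linarith))
  set σ : ℝ := Kdet p q / k12 p q ^ 2 with hσ
  have hk₁₂sq : 0 < k12 p q ^ 2 := sq_pos_of_neg hk₁₂
  have hσpos : 0 < σ := div_pos hK hk₁₂sq
  have hσβ : 0 < α - σ * β := by
    rw [lt_div_iff₀ hK] at hβ
    rw [sub_pos, hσ, div_mul_eq_mul_div, div_lt_iff₀ hk₁₂sq]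
    linarith
  obtain ⟨C₁, hC₁⟩ := exists_abs_integral_mul_le hκ hc h₀pos h₀eq hfcont hfsupp
    (show (0 : ℝ) < 1 / 4 by norm_num)
  obtain ⟨C₂, hC₂⟩ := exists_abs_integral_mul_le hκ hc h₀pos h₀eq hhcont hhsupp
    (show (0 : ℝ) < 1 / 4 by norm_num)
  obtain ⟨B₁, hB₁⟩ := exists_forall_mean_le hκ hc h₀pos h₀eq hVnn hSV hVpos hlogV A
  obtain ⟨B₂, hB₂⟩ := exists_forall_mean_le hκ hc h₀pos h₀eq hUnn hSU hUpos hlogU B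
  refine ⟨1 / 4, σ / 4, -C₁ - σ * C₂ - 2 * π * (2 * α * B₁ + (α - σ * β) * (B₂ / c)),
    by norm_num, by positivity, ?_⟩
  rintro ξ ζ a b u v ⟨-, -, hVint, hUint, hVeq, hUeq⟩ hu hv hξ hζ
  obtain rfl : ξ = fun x => a + u x := funext hξ
  obtain rfl : ζ = fun x => b + v x := funext hζ
  have hVA : ∫ x, V x * Real.exp ((a + u x - (b + v x)) / 2) = A := by
    rw [hA, ← hVeq]
    field_simp
  have hUB : ∫ x, U x * Real.exp (c * (b + v x)) = B := by
    rw [hB, ← hUeq, hVA, add_sub_cancel_right, mul_div_cancel_left₀]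
    simpa using hk₁₂.ne
  have hV₁ (x : Plane) :
      (a + u x - (b + v x)) / 2 = (a - b) / 2 + (1 / 2) * (u x - v x) := by ring
  have hU₁ (x : Plane) : c * (b + v x) = c * b + c * v x := mul_add _ _ _
  simp only [hV₁] at hVint hVA
  simp only [← hcdef, hU₁] at hUint hUB
  have hab : (a - b) / 2 ≤ B₁ := by
    refine hB₁ _ _ ((hu.integrable.sub hv.integrable).const_mul _) ?_ hVint hVA
    rw [integral_const_mul]
    simp [integral_sub hu.integrable hv.integrable, hu.2, hv.2]
  have hb : b ≤ B₂ / c := by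
    rw [le_div_iff₀ hcpos, mul_comm]
    refine hB₂ _ _ (hv.integrable.const_mul c) ?_ hUint hUB
    rw [integral_const_mul, hv.2, mul_zero]
  have hF := (abs_le.1 (hC₁ u hu)).1
  have hH := mul_le_mul_of_nonneg_left (abs_le.1 (hC₂ v hv)).1 hσpos.le
  have hlin : 2 * π * (α * (a - b) + (α - σ * β) * b) ≤
      2 * π * (2 * α * B₁ + (α - σ * β) * (B₂ / c)) := by
    gcongr 2 * π * (?_ + (α - σ * β) * ?_)
    nlinarith
  rw [Ifun_const_add p q hfcont hfsupp hhcont hhsupp hu.1 hv.1, hfint, hhint, ← hσ,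
    show Kdet p q / (2 * k12 p q ^ 2) = σ / 2 by rw [hσ]; field_simp]
  linarith
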